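/- arXiv:2604.01960 — 2 statements merged into one kernel-verified Lean document; each statement's English description precedes it below -/
import Mathlib

section
/- Suppose there exists a top-k set T with T ∩ H_l ≠ ∅ (some object of H_l enters the final top-k), and let b ∈ H_l be an object attaining the minimum lower bound in H_l, i.e., lb_b = min_{j ∈ H_l} lb_j. Then lb_b ≤ Dist_k ≤ ub_b; that is, the estimated interval [lb_b, ub_b] of the top object of H_l contains the k-th smallest exact distance, so this object must be re-ranked. -/
/-- `kthSmallest s k` is the `k`-th smallest element (1-indexed, counted with
multiplicity) of the multiset `s` of reals. -/
noncomputable def kthSmallest (s : Multiset ℝ) (k : ℕ) : ℝ :=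
  (s.sort (· ≤ ·)).getD (k - 1) 0

/-- If at least `k ≥ 1` elements of `s` are at most `x`, so is the `k`-th smallest. -/
theorem kthSmallest_le_of_le_countP {s : Multiset ℝ} {k : ℕ} {x : ℝ} (hk : 1 ≤ k)
    (h : k ≤ s.countP (· ≤ x)) : kthSmallest s k ≤ x := by
  have hs : s.countP (· ≤ x) ≤ s.card := Multiset.countP_le_card _ _
  have hlen : k - 1 < (s.sort (· ≤ ·)).length := by
    rw [Multiset.length_sort]; omega
  have hsort : (s.sort (· ≤ ·)).Pairwise (· ≤ ·) := Multiset.pairwise_sort s (· ≤ ·)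
  rw [← Multiset.sort_eq s (· ≤ ·), Multiset.coe_countP] at h
  unfold kthSmallest
  generalize s.sort (· ≤ ·) = l at *
  rw [List.getD_eq_getElem _ _ hlen]
  by_contra! hx
  rw [← List.take_append_drop (k - 1) l, List.countP_append] at h
  have h1 : (l.take (k - 1)).countP (· ≤ x) ≤ k - 1 :=
    List.countP_le_length.trans (List.length_take_le _ _)
  have h2 : (l.drop (k - 1)).countP (· ≤ x) = 0 := by
    rw [List.countP_eq_zero]
    intro a ha
    obtain ⟨j, hj, rfl⟩ := List.mem_iff_getElem.1 ha
    have hj' : k - 1 + j < l.length := by rw [List.length_drop] at hj; omega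
    have hle : l[k - 1] ≤ l[k - 1 + j] :=
      hsort.rel_get_of_le (a := ⟨k - 1, hlen⟩) (b := ⟨k - 1 + j, hj'⟩)
        (Fin.mk_le_mk.2 (Nat.le_add_right _ _))
    rw [List.getElem_drop]
    simpa using hx.trans_le hle
  omega

/-- If fewer than `k ≤ card s` elements of `s` are less than `x`, the `k`-th smallest is at
least `x`. -/
theorem le_kthSmallest_of_countP_lt {s : Multiset ℝ} {k : ℕ} {x : ℝ} (hks : k ≤ s.card)
    (h : s.countP (· < x) < k) : x ≤ kthSmallest s k := by
  have hlen : k - 1 < (s.sort (· ≤ ·)).length := by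
    rw [Multiset.length_sort]; omega
  have hsort : (s.sort (· ≤ ·)).Pairwise (· ≤ ·) := Multiset.pairwise_sort s (· ≤ ·)
  rw [← Multiset.sort_eq s (· ≤ ·), Multiset.coe_countP] at h
  unfold kthSmallest
  generalize s.sort (· ≤ ·) = l at hlen hsort h ⊢
  rw [List.getD_eq_getElem _ _ hlen]
  by_contra! hx
  have h1 : (l.take k).countP (· < x) = (l.take k).length := by
    rw [List.countP_eq_length]
    intro a ha
    obtain ⟨j, hj, rfl⟩ := List.mem_iff_getElem.1 ha
    rw [List.length_take] at hj
    have hj' : j < l.length := by omega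
    have hle : l[j] ≤ l[k - 1] :=
      hsort.rel_get_of_le (a := ⟨j, hj'⟩) (b := ⟨k - 1, hlen⟩) (Fin.mk_le_mk.2 (by omega))
    rw [List.getElem_take]
    simpa using hle.trans_lt hx
  have h2 : (l.take k).countP (· < x) ≤ l.countP (· < x) :=
    (List.take_sublist k l).countP_le
  rw [h1, List.length_take] at h2
  omega

/-- **If some object of `H_l` enters the final top-`k`, the top object of `H_l`
must be re-ranked.**  With `H_u` a set of size `k` whose upper bounds are the `k`
smallest, `U = max_{i ∈ H_u} ub i`, and `H_l = {j ∉ H_u : lb j ≤ U}`, suppose there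
exists a top-`k` set `T` with `T ∩ H_l ≠ ∅`, and let `b ∈ H_l` attain the minimum
lower bound in `H_l`.  Then `lb b ≤ Dist_k ≤ ub b`: the estimated interval
`[lb b, ub b]` of the top object of `H_l` contains the `k`-th smallest exact
distance. -/
theorem top_of_Hl_must_be_reranked
    (n : ℕ) (d lb ub : Fin n → ℝ)
    (hbd : ∀ i : Fin n, lb i ≤ d i ∧ d i ≤ ub i)
    (k : ℕ) (hk1 : 1 ≤ k) (hkn : k ≤ n)
    (Hu : Finset (Fin n)) (hHu_card : Hu.card = k) (hHu_ne : Hu.Nonempty)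
    (hHu_min : ∀ i ∈ Hu, ∀ j ∉ Hu, ub i ≤ ub j)
    (U : ℝ) (hU : U = Hu.sup' hHu_ne ub)
    (Hl : Finset (Fin n))
    (hHl : Hl = Finset.univ.filter (fun j => j ∉ Hu ∧ lb j ≤ U))
    (T : Finset (Fin n)) (hT_card : T.card = k)
    (hT_top : ∀ i ∈ T, ∀ j ∉ T, d i ≤ d j)
    (hTHl : (T ∩ Hl).Nonempty)
    (hHl_ne : Hl.Nonempty)
    (b : Fin n) (hb : b ∈ Hl) (hbmin : lb b = Hl.inf' hHl_ne lb) :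
    lb b ≤ kthSmallest ((Finset.univ : Finset (Fin n)).val.map d) k ∧
    kthSmallest ((Finset.univ : Finset (Fin n)).val.map d) k ≤ ub b := by
  subst hHl
  have hcount (p : ℝ → Prop) [DecidablePred p] :
      ((Finset.univ : Finset (Fin n)).val.map d).countP p =
        (Finset.univ.filter fun i => p (d i)).card := by
    rw [Multiset.countP_map]; rfl
  constructor
  · obtain ⟨t, ht⟩ := hTHl
    obtain ⟨htT, htHl⟩ := Finset.mem_inter.1 ht
    have hbt : lb b ≤ d t := hbmin ▸ (Finset.inf'_le lb htHl).trans (hbd t).1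
    refine hbt.trans (le_kthSmallest_of_countP_lt (by simpa using hkn) ?_)
    rw [hcount, ← hT_card]
    refine Finset.card_lt_card (Finset.ssubset_iff_of_subset ?_ |>.2 ⟨t, htT, by simp⟩)
    intro i hi
    by_contra hiT
    exact (Finset.mem_filter.1 hi).2.not_ge (hT_top t htT i hiT)
  · refine kthSmallest_le_of_le_countP hk1 ?_
    rw [hcount, ← hHu_card]
    refine Finset.card_le_card fun i hi => Finset.mem_filter.2 ⟨Finset.mem_univ i, ?_⟩
    exact (hbd i).2.trans (hHu_min i hi b (Finset.mem_filter.1 hb).2.1)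
end

section
/- Let D be a finite multiset of real numbers, let k be an integer with 1 ≤ k ≤ |D|, and let a < b be real numbers. Write n_a for the number of elements of D that are strictly less than a, and suppose n_a ≤ k and that the number of elements of D strictly less than b is at least k. Then the multiset of the k smallest elements of D (the first k elements of D in nondecreasing order) equals the multiset of all elements of D that are strictly less than a, together with the (k − n_a) smallest elements of the multiset {x ∈ D : a ≤ x < b}. -/
/-- `kSmallest D j` is the multiset of the `j` smallest elements of the multiset
`D` of reals: the first `j` entries of `D` listed in nondecreasing order
(counted with multiplicity). -/
noncomputable def kSmallest (D : Multiset ℝ) (j : ℕ) : Multiset ℝ :=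
  ((D.sort (· ≤ ·)).take j : List ℝ)

/-- If every element of `s` is at most every element of `t`, sorting `s + t` sorts `s` and `t`
separately. -/
theorem Multiset.sort_add_of_forall_le {α : Type*} [LinearOrder α] {s t : Multiset α}
    (h : ∀ x ∈ s, ∀ y ∈ t, x ≤ y) :
    (s + t).sort (· ≤ ·) = s.sort (· ≤ ·) ++ t.sort (· ≤ ·) := by
  refine List.Perm.eq_of_pairwise' (r := (· ≤ ·)) (Multiset.pairwise_sort _ _) ?_ ?_
  · refine List.pairwise_append.2 ⟨Multiset.pairwise_sort _ _, Multiset.pairwise_sort _ _, ?_⟩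
    simpa using h
  · rw [← Multiset.coe_eq_coe, ← Multiset.coe_add]
    simp only [Multiset.sort_eq]

theorem kSmallest_add_of_le_card {s t : Multiset ℝ} (h : ∀ x ∈ s, ∀ y ∈ t, x ≤ y) {j : ℕ}
    (hj : j ≤ s.card) : kSmallest (s + t) j = kSmallest s j := by
  rw [kSmallest, kSmallest, Multiset.sort_add_of_forall_le h,
    List.take_append_of_le_length (by simpa using hj)]

theorem kSmallest_add_of_card_le {s t : Multiset ℝ} (h : ∀ x ∈ s, ∀ y ∈ t, x ≤ y) {j : ℕ}
    (hj : s.card ≤ j) : kSmallest (s + t) j = s + kSmallest t (j - s.card) := by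
  rw [kSmallest, kSmallest, Multiset.sort_add_of_forall_le h, List.take_append,
    List.take_of_length_le (by simpa using hj), ← Multiset.coe_add, Multiset.sort_eq,
    Multiset.length_sort]

/-- **Correctness of the bucket-based final selection.**  Let `D` be a finite
multiset of reals, `1 ≤ k ≤ |D|`, and `a < b`.  Let `n_a` be the number of
elements of `D` strictly less than `a`; suppose `n_a ≤ k` and the number of
elements of `D` strictly less than `b` is at least `k`.  Then the multiset of
the `k` smallest elements of `D` equals the multiset of all elements of `D`
strictly less than `a`, together with the `k − n_a` smallest elements of the
multiset `{x ∈ D : a ≤ x < b}`. -/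
theorem kSmallest_eq_below_bucket_add_threshold_bucket
    (D : Multiset ℝ) (k : ℕ) (hk1 : 1 ≤ k) (hk : k ≤ Multiset.card D)
    (a b : ℝ) (hab : a < b)
    (na : ℕ) (hna : na = Multiset.card (D.filter (fun x => x < a)))
    (hna_le : na ≤ k)
    (hb_ge : k ≤ Multiset.card (D.filter (fun x => x < b))) :
    kSmallest D k
      = D.filter (fun x => x < a)
        + kSmallest (D.filter (fun x => a ≤ x ∧ x < b)) (k - na) := by
  subst hna
  have hsplit : D.filter (fun x => x < b)
      = D.filter (fun x => x < a) + D.filter (fun x => a ≤ x ∧ x < b) := by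
    rw [← Multiset.filter_add_not (fun x => x < a) (D.filter (fun x => x < b)),
      Multiset.filter_filter, Multiset.filter_filter]
    congr 1 <;> refine Multiset.filter_congr fun x _ => ?_
    · exact ⟨fun h => h.1, fun h => ⟨h, h.trans hab⟩⟩
    · rw [not_lt]
  have hb : kSmallest D k = kSmallest (D.filter (fun x => x < b)) k := by
    conv_lhs => rw [← Multiset.filter_add_not (fun x => x < b) D]
    refine kSmallest_add_of_le_card (fun x hx y hy => ?_) hb_ge
    exact (Multiset.mem_filter.1 hx).2.le.trans (not_lt.1 (Multiset.mem_filter.1 hy).2)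
  rw [hb, hsplit]
  refine kSmallest_add_of_card_le (fun x hx y hy => ?_) hna_le
  exact (Multiset.mem_filter.1 hx).2.le.trans (Multiset.mem_filter.1 hy).2.1
end
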